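/- Let F : ℝ → ℝ be locally Lipschitz and satisfy hypotheses (H)_1 and (H)_2. Then for every ε > 0 there exists L_ε > 0 such that |ξ| ≤ ε|t| + L_ε|t|^{1/2} for every t ∈ ℝ and every ξ ∈ ∂F(t). -/

import Mathlib

open Filter Real

/-- The Clarke generalized directional derivative of `F : ℝ → ℝ` at `t` in direction `s`:
`F⁰(t;s) = limsup_{w → t, τ → 0⁺} (F(w + τs) − F(w))/τ`. -/
noncomputable def clarkeDeriv (F : ℝ → ℝ) (t s : ℝ) : ℝ :=
  Filter.limsup (fun p : ℝ × ℝ => (F (p.1 + p.2 * s) - F p.1) / p.2)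
    ((nhds t) ×ˢ (nhdsWithin 0 (Set.Ioi 0)))

/-- The Clarke subdifferential `∂F(t) = {ξ : ξ·s ≤ F⁰(t;s) for all s}`. -/
def clarkeSubdiff (F : ℝ → ℝ) (t : ℝ) : Set ℝ :=
  {ξ : ℝ | ∀ s : ℝ, ξ * s ≤ clarkeDeriv F t s}

open Topology in
/-- A Lipschitz bound near `t` bounds the difference quotients defining `clarkeDeriv F t s`. -/
lemma eventually_abs_quotient_le {F : ℝ → ℝ} {t K : ℝ} {U : Set ℝ} (hU : U ∈ 𝓝 t)
    (h : ∀ x ∈ U, ∀ y ∈ U, |F x - F y| ≤ K * |x - y|) (s : ℝ) :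
    ∀ᶠ p : ℝ × ℝ in 𝓝 t ×ˢ 𝓝[>] 0, |(F (p.1 + p.2 * s) - F p.1) / p.2| ≤ K * |s| := by
  have hfst : Tendsto (fun p : ℝ × ℝ => p.1) (𝓝 t ×ˢ 𝓝[>] 0) (𝓝 t) := tendsto_fst
  have hsnd : Tendsto (fun p : ℝ × ℝ => p.2) (𝓝 t ×ˢ 𝓝[>] (0 : ℝ)) (𝓝[>] 0) := tendsto_snd
  have hsum : Tendsto (fun p : ℝ × ℝ => p.1 + p.2 * s) (𝓝 t ×ˢ 𝓝[>] 0) (𝓝 t) := by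
    simpa using hfst.add ((hsnd.mono_right nhdsWithin_le_nhds).mul_const s)
  filter_upwards [hfst hU, hsum hU, hsnd self_mem_nhdsWithin] with p h1 h2 h3
  have h3 : 0 < p.2 := h3
  rw [abs_div, abs_of_pos h3, div_le_iff₀ h3]
  calc _ ≤ K * |p.1 + p.2 * s - p.1| := h _ h2 _ h1
    _ = K * |s| * p.2 := by rw [add_sub_cancel_left, abs_mul, abs_of_pos h3]; ring

open Topology in
lemma abs_le_of_mem_clarkeSubdiff {F : ℝ → ℝ} {t K ξ : ℝ} {U : Set ℝ} (hU : U ∈ 𝓝 t)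
    (h : ∀ x ∈ U, ∀ y ∈ U, |F x - F y| ≤ K * |x - y|) (hξ : ξ ∈ clarkeSubdiff F t) :
    |ξ| ≤ K := by
  have key (s : ℝ) : ξ * s ≤ K * |s| := by
    have he := eventually_abs_quotient_le hU h s
    refine (hξ s).trans (limsup_le_of_le ?_ (he.mono fun p hp => (abs_le.1 hp).2))
    exact IsBoundedUnder.isCoboundedUnder_le
      (isBoundedUnder_of_eventually_ge (he.mono fun p hp => (abs_le.1 hp).1))
  have h1 := key 1
  have h2 := key (-1)
  rw [abs_neg, abs_one] at h2
  rw [abs_one] at h1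
  exact abs_le.2 ⟨by linarith, by linarith⟩

open Topology in
/-- Fermat's rule: a slope `m` such that `x ↦ F x - m * x` has a local extremum at `c`
belongs to the Clarke subdifferential at `c`. -/
lemma mem_clarkeSubdiff_of_isLocalExtr {F : ℝ → ℝ} (hF : LocallyLipschitz F) {c m : ℝ}
    (h : IsLocalExtr (fun x => F x - m * x) c) : m ∈ clarkeSubdiff F c := by
  intro s
  obtain ⟨K, U, hU, hK⟩ := hF c
  have he := eventually_abs_quotient_le hU
    (fun x hx y hy => by simpa [Real.dist_eq] using hK.dist_le_mul x hx y hy) s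
  refine le_limsup_of_frequently_le ?_
    (isBoundedUnder_of_eventually_le (he.mono fun p hp => (abs_le.1 hp).2))
  have hid : Tendsto (fun τ : ℝ => τ) (𝓝[>] 0) (𝓝[>] 0) := tendsto_id
  have hlin (r : ℝ) : Tendsto (fun τ : ℝ => c + τ * r) (𝓝[>] 0) (𝓝 c) := by
    simpa using (tendsto_const_nhds (x := c)).add
      ((hid.mono_right nhdsWithin_le_nhds).mul_const r)
  rcases h with h | h
  · refine Tendsto.frequently ((tendsto_const_nhds (x := c)).prodMk hid)
      (Eventually.frequently ?_)
    filter_upwards [(hlin s).eventually h, self_mem_nhdsWithin] with τ h1 h2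
    rw [le_div_iff₀ h2]
    linarith
  · refine Tendsto.frequently ((hlin (-s)).prodMk hid) (Eventually.frequently ?_)
    filter_upwards [(hlin (-s)).eventually h, self_mem_nhdsWithin] with τ h1 h2
    rw [le_div_iff₀ h2]
    rw [show c + τ * -s + τ * s = c by ring]
    linarith

/-- Lebourg's mean value theorem on the real line. -/
lemma exists_mem_clarkeSubdiff_eq_slope {F : ℝ → ℝ} (hF : LocallyLipschitz F) {a b : ℝ}
    (hab : a < b) : ∃ c ∈ Set.Ioo a b, ∃ ξ ∈ clarkeSubdiff F c, F b - F a = ξ * (b - a) := by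
  have hb : b - a ≠ 0 := (sub_pos.2 hab).ne'
  have hcont : Continuous F := hF.continuous
  obtain ⟨c, hc, hext⟩ := exists_isLocalExtr_Ioo
    (f := fun x => F x - (F b - F a) / (b - a) * x) hab (by fun_prop) (by field_simp; ring)
  exact ⟨c, hc, _, mem_clarkeSubdiff_of_isLocalExtr hF hext, by field_simp⟩

/-- A bound on the subdifferentials at the nonzero points of an interval around `0` is a
Lipschitz constant on that interval. -/
lemma abs_sub_le_of_clarkeSubdiff_bound {F : ℝ → ℝ} (hF : LocallyLipschitz F) {r η : ℝ}
    (h : ∀ t : ℝ, 0 < |t| → |t| < r → ∀ ξ ∈ clarkeSubdiff F t, |ξ| ≤ η) :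
    ∀ x ∈ Set.Ioo (-r) r, ∀ y ∈ Set.Ioo (-r) r, |F x - F y| ≤ η * |x - y| := by
  have off (a b : ℝ) (ha : -r < a) (hb : b < r) (hab : a ≤ b) (h0 : 0 ≤ a ∨ b ≤ 0) :
      |F b - F a| ≤ η * (b - a) := by
    rcases hab.eq_or_lt with rfl | hab
    · simp
    obtain ⟨c, hc, ξ, hξ, e⟩ := exists_mem_clarkeSubdiff_eq_slope hF hab
    have hc0 : c ≠ 0 := by
      rintro rfl
      rcases h0 with h0 | h0 <;> linarith [hc.1, hc.2]
    rw [e, abs_mul, abs_of_pos (sub_pos.2 hab)]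
    exact mul_le_mul_of_nonneg_right (h c (abs_pos.2 hc0)
      (abs_lt.2 ⟨by linarith [hc.1], by linarith [hc.2]⟩) ξ hξ) (sub_pos.2 hab).le
  have ordered (a b : ℝ) (ha : -r < a) (hb : b < r) (hab : a ≤ b) :
      |F b - F a| ≤ η * (b - a) := by
    by_cases h0 : 0 ≤ a ∨ b ≤ 0
    · exact off a b ha hb hab h0
    push Not at h0
    have h1 := off a 0 ha (by linarith) h0.1.le (Or.inr le_rfl)
    have h2 := off 0 b (by linarith) hb h0.2.le (Or.inl le_rfl)
    linarith [abs_sub_le (F b) (F 0) (F a)]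
  intro x hx y hy
  rcases le_total x y with hxy | hxy
  · rw [abs_sub_comm, abs_sub_comm x, abs_of_nonneg (sub_nonneg.2 hxy)]
    exact ordered x y hx.1 hy.2 hxy
  · rw [abs_of_nonneg (sub_nonneg.2 hxy)]
    exact ordered y x hy.1 hx.2 hxy

/-- If `∂F(t) = o(1)` as `t → 0`, then `∂F(0) ⊆ {0}`. -/
lemma eq_zero_of_mem_clarkeSubdiff_zero {F : ℝ → ℝ} (hF : LocallyLipschitz F)
    (h : ∀ η > (0 : ℝ), ∃ r > (0 : ℝ), ∀ t : ℝ, 0 < |t| → |t| < r →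
      ∀ ξ ∈ clarkeSubdiff F t, |ξ| ≤ η) {ξ : ℝ} (hξ : ξ ∈ clarkeSubdiff F 0) : ξ = 0 := by
  refine abs_nonpos_iff.1 (le_of_forall_pos_le_add fun η hη => ?_)
  obtain ⟨r, hr, hb⟩ := h η hη
  rw [zero_add]
  exact abs_le_of_mem_clarkeSubdiff (Ioo_mem_nhds (neg_lt_zero.2 hr) hr)
    (abs_sub_le_of_clarkeSubdiff_bound hF hb) hξ

/-- Clarke subdifferentials are uniformly bounded over bounded sets. -/
lemma exists_clarkeSubdiff_bound {F : ℝ → ℝ} (hF : LocallyLipschitz F) (T : ℝ) :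
    ∃ K ≥ (0 : ℝ), ∀ t : ℝ, |t| ≤ T → ∀ ξ ∈ clarkeSubdiff F t, |ξ| ≤ K := by
  obtain ⟨K, hK⟩ := LocallyLipschitzOn.exists_lipschitzOnWith_of_compact
    (isCompact_Icc (a := -(T + 1)) (b := T + 1)) hF.locallyLipschitzOn
  refine ⟨K, K.2, fun t ht ξ hξ => ?_⟩
  have ht := abs_le.1 ht
  exact abs_le_of_mem_clarkeSubdiff (Icc_mem_nhds (a := -(T + 1)) (b := T + 1) (by linarith [ht.1])
      (by linarith [ht.2]))
    (fun x hx y hy => by simpa [Real.dist_eq] using hK.dist_le_mul x hx y hy) hξ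

theorem stmt_3 (F : ℝ → ℝ) (hF : LocallyLipschitz F)
    (H1 : ∀ ε > (0 : ℝ), ∃ δ > (0 : ℝ), ∀ t : ℝ, 0 < |t| → |t| < δ →
      ∀ ξ ∈ clarkeSubdiff F t, |ξ| ≤ ε * |t|)
    (H2 : ∀ ε > (0 : ℝ), ∃ T > (0 : ℝ), ∀ t : ℝ, T < |t| →
      ∀ ξ ∈ clarkeSubdiff F t, |ξ| ≤ ε * |t|) :
    ∀ ε > (0 : ℝ), ∃ L > (0 : ℝ), ∀ t : ℝ, ∀ ξ ∈ clarkeSubdiff F t,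
      |ξ| ≤ ε * |t| + L * |t| ^ ((1 : ℝ) / 2) := by
  intro ε hε
  obtain ⟨δ, hδ, h1⟩ := H1 ε hε
  obtain ⟨T, -, h2⟩ := H2 ε hε
  obtain ⟨K, hK0, hK⟩ := exists_clarkeSubdiff_bound hF T
  have hsδ : 0 < √δ := Real.sqrt_pos.2 hδ
  refine ⟨(K + 1) / √δ, by positivity, fun t ξ hξ => ?_⟩
  rw [← Real.sqrt_eq_rpow]
  have hnn : 0 ≤ (K + 1) / √δ * √|t| := by positivity
  rcases eq_or_ne t 0 with rfl | ht0
  · have hsmall : ∀ η > (0 : ℝ), ∃ r > (0 : ℝ), ∀ t : ℝ, 0 < |t| → |t| < r →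
        ∀ ξ ∈ clarkeSubdiff F t, |ξ| ≤ η := by
      intro η hη
      obtain ⟨r, hr, hb⟩ := H1 1 one_pos
      refine ⟨min r η, lt_min hr hη, fun t ht htr ξ hξ => ?_⟩
      linarith [hb t ht (htr.trans_le (min_le_left _ _)) ξ hξ, htr.trans_le (min_le_right r η)]
    simp [eq_zero_of_mem_clarkeSubdiff_zero hF hsmall hξ]
  rcases lt_or_ge |t| δ with htδ | htδ
  · linarith [h1 t (abs_pos.2 ht0) htδ ξ hξ]
  rcases lt_or_ge T |t| with htT | htT
  · linarith [h2 t htT ξ hξ]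
  have hle : K + 1 ≤ (K + 1) / √δ * √|t| := by
    rw [div_mul_eq_mul_div, le_div_iff₀ hsδ]
    gcongr
  linarith [hK t htT ξ hξ, mul_nonneg hε.le (abs_nonneg t)]
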